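/- Suppose [·,·] is a Lie bracket on ℝ^7 and Λ : ℝ^7 → 𝔤𝔩(7,ℝ) is a linear map with Λ(x)y − Λ(y)x = [x,y] and Λ(x) ∈ 𝔤₂* for all x,y ∈ ℝ^7. Then the infinitesimal holonomy 𝔥 never equals 𝔡 ⋉ 𝔪(1,0,2) = {h(A,v,(y_1,y_2)) : A diagonal, v,y_1,y_2 ∈ ℝ}. -/

import Mathlib

open Matrix

noncomputable section

abbrev V7 : Type := Fin 7 → ℝ
abbrev M7 : Type := Matrix (Fin 7) (Fin 7) ℝ
abbrev M2 : Type := Matrix (Fin 2) (Fin 2) ℝ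

/-- The standard basis of `ℝ^7` (0-indexed: `e 0` is `e_1` of the paper). -/
def e (i : Fin 7) : V7 := Pi.single i 1

/-- The matrix `X(s)` (indices shifted: `s 0 = s_1`, …, `s 13 = s_14`). -/
def Xg2 (s : Fin 14 → ℝ) : M7 :=
  !![s 0 + s 3, -s 9, s 8, Real.sqrt 2 * s 5, 0, -s 10, -s 11;
     -s 7, s 0, s 1, Real.sqrt 2 * s 8, s 10, 0, s 5;
     s 6, s 2, s 3, Real.sqrt 2 * s 9, s 11, -s 5, 0;
     Real.sqrt 2 * s 4, Real.sqrt 2 * s 6, Real.sqrt 2 * s 7, 0,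
       Real.sqrt 2 * s 5, Real.sqrt 2 * s 8, Real.sqrt 2 * s 9;
     0, s 12, s 13, Real.sqrt 2 * s 4, -s 0 - s 3, s 7, -s 6;
     -s 12, 0, -s 4, Real.sqrt 2 * s 6, s 9, -s 0, -s 2;
     -s 13, s 4, 0, Real.sqrt 2 * s 7, -s 8, -s 1, -s 3]

/-- `𝔤₂* = {X(s) : s ∈ ℝ^14}`. -/
def g2star : Set M7 := Set.range Xg2

/-- The matrix `h(A,v,u,y)`. -/
def hmat (A : M2) (v : ℝ) (u y : Fin 2 → ℝ) : M7 :=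
  !![A 0 0 + A 1 1, -u 1, u 0, Real.sqrt 2 * v, 0, -y 0, -y 1;
     0, A 0 0, A 0 1, Real.sqrt 2 * u 0, y 0, 0, v;
     0, A 1 0, A 1 1, Real.sqrt 2 * u 1, y 1, -v, 0;
     0, 0, 0, 0, Real.sqrt 2 * v, Real.sqrt 2 * u 0, Real.sqrt 2 * u 1;
     0, 0, 0, 0, -(A 0 0 + A 1 1), 0, 0;
     0, 0, 0, 0, u 1, -A 0 0, -A 1 0;
     0, 0, 0, 0, -u 0, -A 0 1, -A 1 1]

/-- `𝔥^I = {h(A,v,u,y)}`. -/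
def hI : Set M7 := {X | ∃ A v u y, X = hmat A v u y}

/-- The matrix `h(A,v,y) := h(A,v,0,y)`. -/
def h3 (A : M2) (v : ℝ) (y : Fin 2 → ℝ) : M7 := hmat A v 0 y

/-- `𝔥^III = {h(A,v,y)}`. -/
def hIII : Set M7 := {X | ∃ A v y, X = h3 A v y}

/-- `𝔪(1,0,1) = {h(0,v,(y_1,0))}`. -/
def m101 : Set M7 := {X | ∃ v y1, X = h3 0 v ![y1, 0]}

/-- `𝔪(1,0,2) = {h(0,v,(y_1,y_2))}`. -/
def m102 : Set M7 := {X | ∃ v y, X = h3 0 v y}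

/-- The curvature `R(x,y) = Λ(x)Λ(y) − Λ(y)Λ(x) − Λ([x,y])`. -/
def curv (L : V7 →ₗ[ℝ] M7) (bk : V7 → V7 → V7) (x y : V7) : M7 :=
  L x * L y - L y * L x - L (bk x y)

/-- The infinitesimal holonomy: the smallest linear subspace of `𝔤𝔩(7,ℝ)` containing
all `R(x,y)` and stable under bracketing with all `Λ(z)`. -/
def infHol (L : V7 →ₗ[ℝ] M7) (bk : V7 → V7 → V7) : Submodule ℝ M7 :=
  sInf {H : Submodule ℝ M7 | (∀ x y, curv L bk x y ∈ H) ∧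
    ∀ z : V7, ∀ X ∈ H, L z * X - X * L z ∈ H}

/-- `𝔰𝔩(2,ℝ)` as a set of 2×2 matrices. -/
def sl2 : Set M2 := {A | A 0 0 + A 1 1 = 0}

/-- `𝔤𝔩(2,ℝ)` as a set of 2×2 matrices. -/
def gl2 : Set M2 := Set.univ

/-- `𝔠𝔬(2) = {(a,−b;b,a)}`. -/
def co2 : Set M2 := {A | ∃ a b : ℝ, A = !![a, -b; b, a]}

/-- `𝔡`, the diagonal 2×2 matrices. -/
def dd : Set M2 := {A | A 0 1 = 0 ∧ A 1 0 = 0}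

/-- `ℝ·diag(1,0)`. -/
def rdiag10 : Set M2 := {A | ∃ t : ℝ, A = !![t, 0; 0, 0]}

/-- `𝔞 ⋉ 𝔪(1,0,k)`. -/
def semidir (a : Set M2) : ℕ → Set M7
  | 1 => {X | ∃ A ∈ a, ∃ v y1, X = h3 A v ![y1, 0]}
  | _ => {X | ∃ A ∈ a, ∃ v y, X = h3 A v y}

/-- The pairs `(𝔞, k)` occurring in the list of type III holonomy algebras. -/
def ListedPair (a : Set M2) (k : ℕ) : Prop :=
  ((a = sl2 ∨ a = gl2 ∨ a = co2 ∨ a = dd) ∧ k = 2) ∨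
  ((a = ({0} : Set M2) ∨ a = rdiag10) ∧ (k = 1 ∨ k = 2))

/-- The listed type III holonomy algebras `𝔞 ⋉ 𝔪(1,0,k)`. -/
def ListedTypeIII (S : Set M7) : Prop := ∃ a k, ListedPair a k ∧ S = semidir a k

/-- A matrix in `𝔡 ⋉ 𝔪(1,0,2)` is determined by five of its entries. -/
theorem eq_of_mem_semidir_dd {X : M7} (hX : X ∈ semidir dd 2) :
    X = h3 !![X 1 1, 0; 0, X 2 2] (X 1 6) ![X 1 4, X 2 4] := by
  obtain ⟨A, ⟨h01, h10⟩, v, y, rfl⟩ := hX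
  ext i j
  fin_cases i <;> fin_cases j <;> simp [h3, hmat, h01, h10]

theorem h3_diagonal_mem_semidir_dd (a d v : ℝ) (y : Fin 2 → ℝ) :
    h3 !![a, 0; 0, d] v y ∈ semidir dd 2 :=
  ⟨_, ⟨rfl, rfl⟩, v, y, rfl⟩

theorem h3_diagonal_mulVec (a d v p q : ℝ) (z : V7) :
    (h3 !![a, 0; 0, d] v ![p, q]).mulVec z =
      ![(a + d) * z 0 + Real.sqrt 2 * v * z 3 - p * z 5 - q * z 6,
        a * z 1 + p * z 4 + v * z 6,
        d * z 2 + q * z 4 - v * z 5,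
        Real.sqrt 2 * v * z 4,
        -(a + d) * z 4,
        -a * z 5,
        -d * z 6] := by
  ext i
  fin_cases i <;> simp [h3, hmat, Matrix.mulVec, dotProduct, Fin.sum_univ_succ] <;> ring

theorem mulVec_of_mem_semidir_dd {X : M7} (hX : X ∈ semidir dd 2) (z : V7) :
    X.mulVec z =
      ![(X 1 1 + X 2 2) * z 0 + Real.sqrt 2 * X 1 6 * z 3 - X 1 4 * z 5 - X 2 4 * z 6,
        X 1 1 * z 1 + X 1 4 * z 4 + X 1 6 * z 6,
        X 2 2 * z 2 + X 2 4 * z 4 - X 1 6 * z 5,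
        Real.sqrt 2 * X 1 6 * z 4,
        -(X 1 1 + X 2 2) * z 4,
        -X 1 1 * z 5,
        -X 2 2 * z 6] := by
  conv_lhs => rw [eq_of_mem_semidir_dd hX]
  exact h3_diagonal_mulVec _ _ _ _ _ _

/-- Commutators in `𝔡 ⋉ 𝔪(1,0,2)` have no `𝔡`-component. -/
theorem commutator_diag_of_mem_semidir_dd {X Y : M7} (hX : X ∈ semidir dd 2)
    (hY : Y ∈ semidir dd 2) :
    (X * Y - Y * X) 1 1 = 0 ∧ (X * Y - Y * X) 2 2 = 0 := by
  obtain ⟨A, ⟨hA, hA'⟩, v, y, rfl⟩ := hX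
  obtain ⟨B, ⟨hB, hB'⟩, w, u, rfl⟩ := hY
  constructor <;>
    simp [h3, hmat, hA, hA', hB, hB'] <;> ring

/-- `𝔡 ⋉ 𝔪(1,0,2)` is self-normalizing in `𝔤₂*`; bracketing with one regular element of `𝔡`
suffices. -/
theorem mem_semidir_dd_of_commutator_mem {X : M7} (hX : X ∈ g2star)
    (h : X * h3 !![1, 0; 0, 3] 0 ![0, 0] - h3 !![1, 0; 0, 3] 0 ![0, 0] * X ∈ semidir dd 2) :
    X ∈ semidir dd 2 := by
  obtain ⟨s, rfl⟩ := hX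
  obtain ⟨A, ⟨hA, hA'⟩, v, y, hE⟩ := h
  have key (i j : Fin 7) := congrFun (congrFun hE i) j
  have h1 := key 1 2
  have h2 := key 2 1
  have h4 := key 5 2
  have h6 := key 4 6
  have h7 := key 4 5
  have h8 := key 0 2
  have h9 := key 0 1
  have h12 := key 4 1
  have h13 := key 4 2
  simp [Xg2, h3, hmat, hA, hA'] at h1 h2 h4 h6 h7 h8 h9 h12 h13
  have e1 : s 1 = 0 := by linarith
  have e2 : s 2 = 0 := by linarith
  have e4 : s 4 = 0 := by linarith
  have e6 : s 6 = 0 := by linarith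
  have e7 : s 7 = 0 := by linarith
  have e8 : s 8 = 0 := by linarith
  have e9 : s 9 = 0 := by linarith
  have e12 : s 12 = 0 := by linarith
  have e13 : s 13 = 0 := by linarith
  refine ⟨!![s 0, 0; 0, s 3], ⟨rfl, rfl⟩, s 5, ![s 10, s 11], ?_⟩
  ext i j
  fin_cases i <;> fin_cases j <;>
    simp [Xg2, h3, hmat, e1, e2, e4, e6, e7, e8, e9, e12, e13]
  ring

theorem curv_mem_infHol (L : V7 →ₗ[ℝ] M7) (bk : V7 → V7 → V7) (x y : V7) :
    curv L bk x y ∈ infHol L bk :=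
  Submodule.mem_sInf.2 fun _ hH => hH.1 x y

theorem commutator_mem_infHol (L : V7 →ₗ[ℝ] M7) (bk : V7 → V7 → V7) (z : V7) {X : M7}
    (hX : X ∈ infHol L bk) : L z * X - X * L z ∈ infHol L bk :=
  Submodule.mem_sInf.2 fun H hH => hH.2 z X (Submodule.mem_sInf.1 hX H hH)

/-- The first Bianchi identity for a torsion-free connection on a Lie algebra. -/
theorem curv_bianchi {bk : V7 → V7 → V7} {L : V7 →ₗ[ℝ] M7}
    (hbk : ∀ x y : V7, (L x).mulVec y - (L y).mulVec x = bk x y)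
    (hjac : ∀ x y z : V7, bk (bk x y) z + bk (bk y z) x + bk (bk z x) y = 0) (x y z : V7) :
    (curv L bk x y).mulVec z + (curv L bk y z).mulVec x + (curv L bk z x).mulVec y = 0 := by
  have h := hjac x y z
  rw [← hbk (bk x y) z, ← hbk (bk y z) x, ← hbk (bk z x) y] at h
  have hz : (L z).mulVec (bk x y) = (L z * L x).mulVec y - (L z * L y).mulVec x := by
    rw [← hbk, Matrix.mulVec_sub, Matrix.mulVec_mulVec, Matrix.mulVec_mulVec]
  have hx : (L x).mulVec (bk y z) = (L x * L y).mulVec z - (L x * L z).mulVec y := by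
    rw [← hbk, Matrix.mulVec_sub, Matrix.mulVec_mulVec, Matrix.mulVec_mulVec]
  have hy : (L y).mulVec (bk z x) = (L y * L z).mulVec x - (L y * L x).mulVec z := by
    rw [← hbk, Matrix.mulVec_sub, Matrix.mulVec_mulVec, Matrix.mulVec_mulVec]
  rw [hz, hx, hy] at h
  simp only [curv, Matrix.sub_mulVec]
  rw [← neg_eq_zero, ← h]
  abel

/-- A diagonal entry vanishing on all curvatures and on all brackets `[Λ(z), X]` with `X` in the
infinitesimal holonomy vanishes on the infinitesimal holonomy. -/
theorem infHol_apply_eq_zero {bk : V7 → V7 → V7} {L : V7 →ₗ[ℝ] M7} (i : Fin 7)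
    (hol : ∀ X ∈ infHol L bk, ∀ z, (L z * X - X * L z) i i = 0)
    (hc : ∀ x y, curv L bk x y i i = 0) {X : M7} (hX : X ∈ infHol L bk) : X i i = 0 := by
  let H : Submodule ℝ M7 := infHol L bk ⊓ LinearMap.ker (Matrix.entryLinearMap ℝ ℝ i i)
  have hH : infHol L bk ≤ H := by
    refine sInf_le ⟨fun x y => ⟨curv_mem_infHol L bk x y, ?_⟩, fun z X hX =>
      ⟨commutator_mem_infHol L bk z hX.1, ?_⟩⟩
    · simpa using hc x y
    · exact hol X hX.1 z
  simpa using (hH hX).2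

theorem bracket_antisymm {bk : V7 → V7 → V7} {L : V7 →ₗ[ℝ] M7}
    (hbk : ∀ x y : V7, (L x).mulVec y - (L y).mulVec x = bk x y) (x y : V7) :
    bk x y = -bk y x := by
  rw [← hbk, ← hbk, neg_sub]

theorem curv_antisymm {bk : V7 → V7 → V7} {L : V7 →ₗ[ℝ] M7}
    (hbk : ∀ x y : V7, (L x).mulVec y - (L y).mulVec x = bk x y) (x y : V7) :
    curv L bk x y = -curv L bk y x := by
  simp only [curv, bracket_antisymm hbk x y, map_neg]
  abel

/-- The first Bianchi identity determines the `𝔡`-components of a curvature with values in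
`𝔡 ⋉ 𝔪(1,0,2)` up to two scalars. -/
theorem exists_curv_diag_eq {bk : V7 → V7 → V7} {L : V7 →ₗ[ℝ] M7}
    (hbk : ∀ x y : V7, (L x).mulVec y - (L y).mulVec x = bk x y)
    (hjac : ∀ x y z : V7, bk (bk x y) z + bk (bk y z) x + bk (bk z x) y = 0)
    (hR : ∀ x y, curv L bk x y ∈ semidir dd 2) :
    (∃ r : ℝ, ∀ x y, curv L bk x y 1 1 = r * (x 4 * y 5 - x 5 * y 4)) ∧
      ∃ s : ℝ, ∀ x y, curv L bk x y 2 2 = s * (x 4 * y 6 - x 6 * y 4) := by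
  have hB (x y z : V7) (i : Fin 7) := congrFun (curv_bianchi hbk hjac x y z) i
  simp only [mulVec_of_mem_semidir_dd (hR _ _), Pi.add_apply, Pi.zero_apply] at hB
  have hs : Real.sqrt 2 ≠ 0 := by positivity
  have hB1 (x y z : V7) := hB x y z 1
  have hB2 (x y z : V7) := hB x y z 2
  have hB3 (x y z : V7) := hB x y z 3
  have hB4 (x y z : V7) := hB x y z 4
  have hB5 (x y z : V7) := hB x y z 5
  have hB6 (x y z : V7) := hB x y z 6
  simp at hB1 hB2 hB3 hB4 hB5 hB6
  have anti (x y : V7) (i : Fin 7) : curv L bk x y i i = -curv L bk y x i i := by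
    rw [curv_antisymm hbk x y, Matrix.neg_apply]
  constructor
  · have hV : curv L bk (e 1) (e 5) 1 6 = 0 := by simpa [e, hs] using hB3 (e 1) (e 5) (e 4)
    have hD : curv L bk (e 1) (e 5) 2 2 = 0 := by simpa [e] using hB6 (e 1) (e 5) (e 6)
    have hA : curv L bk (e 1) (e 5) 1 1 = 0 := by
      have := hB4 (e 1) (e 5) (e 4)
      simp [e] at this hD
      simpa [e, hD] using this
    have h5 (y : V7) : curv L bk (e 5) y 1 1 = -curv L bk (e 1) (e 5) 1 4 * y 4 := by
      have := hB1 (e 5) y (e 1)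
      simp [e] at this hV hA ⊢
      rw [hV, hA] at this
      linarith
    refine ⟨curv L bk (e 1) (e 5) 1 4, fun x y => ?_⟩
    have h := hB5 x y (e 5)
    rw [anti y, h5, h5] at h
    simp [e] at h ⊢
    linarith
  · have hV : curv L bk (e 2) (e 6) 1 6 = 0 := by simpa [e, hs] using hB3 (e 2) (e 6) (e 4)
    have hA : curv L bk (e 2) (e 6) 1 1 = 0 := by simpa [e] using hB5 (e 2) (e 6) (e 5)
    have hD : curv L bk (e 2) (e 6) 2 2 = 0 := by
      have := hB4 (e 2) (e 6) (e 4)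
      simp [e] at this hA
      simpa [e, hA] using this
    have h6 (y : V7) : curv L bk (e 6) y 2 2 = -curv L bk (e 2) (e 6) 2 4 * y 4 := by
      have := hB2 (e 6) y (e 2)
      simp [e] at this hV hD ⊢
      rw [hV, hD] at this
      linarith
    refine ⟨curv L bk (e 2) (e 6) 2 4, fun x y => ?_⟩
    have h := hB6 x y (e 6)
    rw [anti y, h6, h6] at h
    simp [e] at h ⊢
    linarith

/-- A linear functional vanishing on the first four basis vectors is determined by the other
three. -/
theorem linearMap_apply_eq_of_e_eq_zero (f : V7 →ₗ[ℝ] ℝ)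
    (h : ∀ z : V7, z 4 = 0 → z 5 = 0 → z 6 = 0 → f z = 0) (x : V7) :
    f x = x 4 * f (e 4) + x 5 * f (e 5) + x 6 * f (e 6) := by
  have := h (x - (x 4 • e 4 + x 5 • e 5 + x 6 • e 6)) (by simp [e]) (by simp [e]) (by simp [e])
  simp only [map_sub, map_add, map_smul, smul_eq_mul] at this
  linarith

theorem stmt12 (bk : V7 → V7 → V7) (L : V7 →ₗ[ℝ] M7)
    (hbk : ∀ x y : V7, (L x).mulVec y - (L y).mulVec x = bk x y)
    (halt : ∀ x : V7, bk x x = 0)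
    (hjac : ∀ x y z : V7, bk (bk x y) z + bk (bk y z) x + bk (bk z x) y = 0)
    (hL : ∀ x, L x ∈ g2star) :
    (infHol L bk : Set M7) ≠ semidir dd 2 := by
  intro hol
  have mem_iff (X : M7) : X ∈ infHol L bk ↔ X ∈ semidir dd 2 := by
    rw [← hol]; rfl
  have hLmem (z : V7) : L z ∈ semidir dd 2 :=
    mem_semidir_dd_of_commutator_mem (hL z) ((mem_iff _).1
      (commutator_mem_infHol L bk z ((mem_iff _).2 (h3_diagonal_mem_semidir_dd _ _ _ _))))
  have hRmem (x y : V7) : curv L bk x y ∈ semidir dd 2 :=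
    (mem_iff _).1 (curv_mem_infHol L bk x y)
  obtain ⟨⟨r, hr⟩, s, hs⟩ := exists_curv_diag_eq hbk hjac hRmem
  have hr0 : r ≠ 0 := by
    rintro rfl
    have := infHol_apply_eq_zero 1
      (fun X hX z => (commutator_diag_of_mem_semidir_dd (hLmem z) ((mem_iff X).1 hX)).1)
      (fun x y => by rw [hr, zero_mul])
      ((mem_iff _).2 (h3_diagonal_mem_semidir_dd 1 0 0 0))
    simp [h3, hmat] at this
  have hs0 : s ≠ 0 := by
    rintro rfl
    have := infHol_apply_eq_zero 2
      (fun X hX z => (commutator_diag_of_mem_semidir_dd (hLmem z) ((mem_iff X).1 hX)).2)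
      (fun x y => by rw [hs, zero_mul])
      ((mem_iff _).2 (h3_diagonal_mem_semidir_dd 0 1 0 0))
    simp [h3, hmat] at this
  let α : V7 →ₗ[ℝ] ℝ := Matrix.entryLinearMap ℝ ℝ 1 1 ∘ₗ L
  let δ : V7 →ₗ[ℝ] ℝ := Matrix.entryLinearMap ℝ ℝ 2 2 ∘ₗ L
  have hα (x y : V7) : α (bk x y) = -r * (x 4 * y 5 - x 5 * y 4) := by
    have := (commutator_diag_of_mem_semidir_dd (hLmem x) (hLmem y)).1
    have h := hr x y
    rw [curv, Matrix.sub_apply, this] at h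
    change L (bk x y) 1 1 = _
    linarith
  have hδ (x y : V7) : δ (bk x y) = -s * (x 4 * y 6 - x 6 * y 4) := by
    have := (commutator_diag_of_mem_semidir_dd (hLmem x) (hLmem y)).2
    have h := hs x y
    rw [curv, Matrix.sub_apply, this] at h
    change L (bk x y) 2 2 = _
    linarith
  have hbk4 (x y : V7) : bk x y 4 = -(α x + δ x) * y 4 + (α y + δ y) * x 4 := by
    rw [← hbk, mulVec_of_mem_semidir_dd (hLmem x), mulVec_of_mem_semidir_dd (hLmem y)]
    simp [α, δ]
    ring
  have hbk5 (x y : V7) : bk x y 5 = -α x * y 5 + α y * x 5 := by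
    rw [← hbk, mulVec_of_mem_semidir_dd (hLmem x), mulVec_of_mem_semidir_dd (hLmem y)]
    simp [α]
  have hbk6 (x y : V7) : bk x y 6 = -δ x * y 6 + δ y * x 6 := by
    rw [← hbk, mulVec_of_mem_semidir_dd (hLmem x), mulVec_of_mem_semidir_dd (hLmem y)]
    simp [δ]
  have hαδ (z : V7) (h4 : z 4 = 0) (h5 : z 5 = 0) : 2 * α z + δ z = 0 := by
    have h := congrArg α (hjac (e 4) (e 5) z)
    simp only [map_add, map_zero, hα, hbk4, hbk5] at h
    simp [e, h4, h5] at h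
    refine (mul_eq_zero.1 (?_ : r * _ = 0)).resolve_left hr0
    linarith
  have hδα (z : V7) (h4 : z 4 = 0) (h6 : z 6 = 0) : α z + 2 * δ z = 0 := by
    have h := congrArg δ (hjac (e 4) (e 6) z)
    simp only [map_add, map_zero, hδ, hbk4, hbk6] at h
    simp [e, h4, h6] at h
    refine (mul_eq_zero.1 (?_ : s * _ = 0)).resolve_left hs0
    linarith
  have hα' := linearMap_apply_eq_of_e_eq_zero α fun z h4 h5 h6 => by
    linarith [hαδ z h4 h5, hδα z h4 h6]
  have hδ' := linearMap_apply_eq_of_e_eq_zero δ fun z h4 h5 h6 => by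
    linarith [hαδ z h4 h5, hδα z h4 h6]
  have h56 := hα (e 5) (e 6)
  have h45 := hα (e 4) (e 5)
  have h46 := hδ (e 4) (e 6)
  have h5 := hδα (e 5) (by simp [e]) (by simp [e])
  rw [hα', hbk4, hbk5, hbk6] at h56 h45
  rw [hδ', hbk4, hbk5, hbk6] at h46
  generalize α (e 4) = a4, α (e 5) = a5, α (e 6) = a6, δ (e 4) = d4, δ (e 5) = d5,
    δ (e 6) = d6 at h56 h45 h46 h5
  simp [e] at h56 h45 h46
  have hd5 : d5 ≠ 0 := by
    rintro rfl
    exact hr0 (by linarith)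
  have ha6 : a6 ≠ 0 := by
    rintro rfl
    exact hs0 (by linarith)
  refine mul_ne_zero ha6 hd5 ?_
  have : a5 = -2 * d5 := by linarith
  rw [this] at h56
  linarith
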